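/- arXiv:2205.13168 — 3 statements merged into one kernel-verified Lean document; each statement's English description precedes it below -/
import Mathlib

section
/- There are no positive integers m, n, k, x with 3 ≤ m ≤ 1457, 3 ≤ k ≤ 13 and 21 ≤ x ≤ 850192 satisfying (F_{m+1}^{(k)})^x − (F_{m-1}^{(k)})^x = F_n^{(k)}. -/
/-- `atanhSum a b n d T` approximates from below `∑ j < n, T * (a / b) ^ j / (d + 2 * j)` using
integer divisions only. -/
def atanhSum (a b : ℕ) : ℕ → ℕ → ℕ → ℕ
  | 0, _, _ => 0
  | n + 1, d, T => T / d + atanhSum a b n (d + 2) (T * a / b)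

/-- An integer close to `2 ^ 96 * log 2`. -/
def fixedLogTwo : ℕ := 54916777467707473351141471098

/-- An integer close to `2 ^ 96 * log N`. -/
def fixedLog (N : ℕ) : ℕ :=
  Nat.log2 N * fixedLogTwo +
    2 * atanhSum ((N - 2 ^ Nat.log2 N) ^ 2) ((N + 2 ^ Nat.log2 N) ^ 2) 31 1
      (2 ^ 96 * (N - 2 ^ Nat.log2 N) / (N + 2 ^ Nat.log2 N))

/-- The test behind the reduction step: `la`, `lc`, `R` are within `2 ^ 40` of `2 ^ 96` times the
logarithm of the dominant root, of the leading coefficient, and of the relative deviation of a term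
from its leading asymptotics; `p` and `u` are meant to be the integers nearest to
`q * (lc + R) / la` and `q * R / la`. -/
def reductionTestWith (la lc R q p u : ℤ) : Bool :=
  let err := (q + |u|) * 2 ^ 40
  let thr := q * (2 * 2 ^ 96 / 10 ^ 11 + 1) +
    850192 * (|q * (lc + R) - p * la| + (2 * q + |p|) * 2 ^ 40)
  decide (0 < q) && decide (|q * R - u * la| + err + thr < la - 2 ^ 40) &&
    (decide (err + thr < |q * R - u * la|) ||
      (decide (u = 0) && decide (850192 < q) && decide (Int.gcd p q = 1)))

/-- `reductionTestWith` at the nearest integers. -/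
def reductionTest (la lc R q : ℤ) : Bool :=
  reductionTestWith la lc R q ((2 * q * (lc + R) + la) / (2 * la)) ((2 * q * R + la) / (2 * la))

/-- Shift a window of consecutive terms of a generalized Fibonacci sequence by one. -/
def shiftWindow (w : List ℕ) : List ℕ := w.tail ++ [w.sum]

/-- Run `reductionTest` along consecutive windows, with one multiplier `q` for each. -/
def reductionTests (la lc : ℤ) : List ℕ → ℕ → List ℕ → Bool
  | [], _, _ => true
  | q :: qs, m, w =>
    reductionTest la lc (fixedLog w.sum - lc - m * la) q &&
      reductionTests la lc qs (m + 1) (shiftWindow w)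

/-- The integer part of `2 ^ 96 * α`, where `α` is the dominant root for the order `k`. -/
def fixedRoot : ℕ → ℕ
  | 3 => 145723309952441487718711042725
  | 4 => 152717193449877616732191153904
  | 5 => 155758466387579916525195286698
  | 6 => 157155623879329078280187746800
  | 7 => 157819663091219712744349585733
  | 8 => 158141882691616196721744607667
  | 9 => 158300203578229935068878770621
  | 10 => 158378573101398385038221142001
  | 11 => 158417535076897615782825195281
  | 12 => 158436953817055883681479933815
  | 13 => 158446645938745078224077667813
  | _ => 0

/-- The multiplier for the order `k` used for all large indices. -/
def asymptoticMultiplier : ℕ → ℕ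
  | 3 => 1050040
  | 4 => 941173
  | 5 => 2354695
  | 6 => 974912
  | 7 => 2580911
  | 8 => 2089417
  | 9 => 1141327
  | 10 => 1671735
  | 11 => 3971210
  | 12 => 6446482
  | 13 => 1782519
  | _ => 0

/-- The multipliers for the order `k` used for the indices `m = 3, 4, …`. -/
def initialMultipliers : ℕ → List ℕ
  | 3 =>
    [326413, 389055, 1808305, 1528145, 3501407, 1874870, 609929, 1777467, 1282693, 790946,
      635951, 85385, 253497, 1402676, 1303357, 2202693, 2553661, 1144406, 3614711, 994132,
      1292849, 4533247, 955532, 1208793, 2644303, 852881, 6017421, 2318654]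
  | 4 =>
    [526900, 1452747, 1645282, 1385321, 1099808, 2607102, 10900877, 372173, 117958, 765932,
      1238339, 3150284, 162520, 1345030, 1036913, 2942370, 1712393, 1541506, 40035408, 1173937,
      5497963, 1537353, 2723794, 1001448, 1127917, 1742288, 3462000, 1475761, 941173, 1022490]
  | 5 =>
    [515233, 515233, 515233, 1525491, 163620, 1574371, 1657369, 981996, 95652, 1854366, 503627,
      486149, 907957, 1641323, 2908181, 9548201, 850915, 17739611, 3853243, 4675761, 107228643,
      1304606423, 2812163, 1048341, 1075167, 1548356, 1064062, 8625709, 1908187, 1097377,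
      1097377, 2354695, 649244806, 9269944]
  | 6 =>
    [4568342, 1247280, 935460, 2097079, 1111876, 2503059, 4381147, 1727273, 3176145, 3376153,
      2002251, 2241493, 3197963, 2648420, 11791892, 1398262, 4677539, 1055653, 2663971, 5400074,
      1384686, 1005152, 1595968, 1093880, 4628058, 1295261, 1231494, 969115, 3427063, 1622921,
      1301815]
  | 7 =>
    [1454157, 11961499, 1454157, 2780075, 484719, 15423139, 1135801, 3491120, 6385382, 415461,
      1026549, 1122884, 1020243, 356253, 887139, 2453998, 7566960, 149633, 1268869, 1297774,
      8440099, 882463, 3963079, 2390453, 1163277, 7867249, 2846956, 863675, 1237424, 1648213,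
      1200384, 1057281, 2580911, 5932897]
  | 8 =>
    [3247588, 960457, 1623794, 722761, 2287131, 4227787, 109354, 1022214, 2382423, 1690897,
      1234709, 783583, 806231, 729711, 66665, 1275159, 1269415, 1609601, 1127823, 983777,
      1218558, 2750885, 9128275, 1402670, 1205089, 1524073, 3172587, 1126561, 1227329, 1708757,
      1041212, 933451, 1594003]
  | 9 =>
    [1653252, 2519843, 3070927, 283535, 3070927, 202525, 3070927, 1469439, 9732323, 4390289,
      559979, 1265477, 2721539, 1818859, 4292957, 1073407, 1204542, 5700095, 17349757, 1445777,
      1146113, 892207, 1286273, 1795080, 6023642, 3375134, 1049016, 1080318, 873964, 1081913,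
      1171034, 23644280, 1171034]
  | 10 =>
    [218041, 2793371, 4735159, 1763239, 3011412, 4027559, 2258559, 2007608, 1356415, 2164129,
      2259496, 5275791, 1090195, 1370807, 1310238, 1057942, 1060337, 1620655, 993585, 1431211,
      921671, 1549187, 1186637, 3155163, 1460922, 1534768, 3258371, 5400787, 2835866, 1006241,
      1107164, 1993493, 5336963]
  | 11 =>
    [6234817, 120753, 6234817, 6234817, 120753, 4505192, 3942043, 40251, 6234817, 5990207,
      1101916, 997069, 1450720, 1447343, 1321239, 834161, 1080836, 914093, 861647, 960838,
      2326665, 1196920, 2705861, 967455, 1052837, 1976345, 2638998, 5881007, 930100, 1632619,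
      1131313, 1319342, 1540331, 2203298, 2645276]
  | 12 =>
    [796437, 530958, 1928738, 293633, 265479, 2449641, 4653913, 176986, 1090070, 423083, 307718,
      596662, 1971091, 6644063, 867257, 1794994, 1796017, 897115, 3307990, 973514, 1103189,
      904411, 1824701, 991636, 2190547, 1318972, 36249925, 906687, 1072054, 880636, 4805271,
      5470137, 5184709, 76256281, 5875626]
  | 13 =>
    [209904, 3010515, 6056014, 9773584, 6090998, 880138, 6108490, 1003505, 4886792, 1158340,
      3045499, 2343173, 5149097, 871369, 1162111, 1044513, 1008385, 3291061, 18899362, 1184599,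
      2651643, 1051573, 1153631, 19579767, 1629938, 10176545, 1048480, 1025799, 19150997,
      22156227, 1047449, 7353793, 980437, 13525082, 1782519, 1782519, 1782519, 2473258, 2473258]
  | _ => []

/-- An integer close to `2 ^ 96 * log α`. -/
def fixedLogRoot (k : ℕ) : ℤ := fixedLog (fixedRoot k) - 96 * fixedLogTwo

/-- An integer close to `2 ^ 96 * log c`, where `c = (α - 1) / (α - k * (2 - α))`. -/
def fixedLogCoeff (k : ℕ) : ℤ :=
  fixedLog (fixedRoot k - 2 ^ 96) - fixedLog ((k + 1) * fixedRoot k - 2 * k * 2 ^ 96)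

/-- All numerical tests for the order `k`. -/
def orderTest (k : ℕ) : Bool :=
  let la := fixedLogRoot k
  let lc := fixedLogCoeff k
  let qs := initialMultipliers k
  let q := asymptoticMultiplier k
  decide (2 ^ (96 * (k + 1)) < fixedRoot k ^ k * (2 * 2 ^ 96 - fixedRoot k)) &&
    decide ((fixedRoot k + 1) ^ k * (2 * 2 ^ 96 - (fixedRoot k + 1)) < 2 ^ (96 * (k + 1))) &&
    decide (9 * 2 ^ 96 ≤ 5 * fixedRoot k) &&
    decide (fixedRoot k + 1 < 2 * 2 ^ 96) &&
    decide (2 * k * 2 ^ 96 + 2 ^ 96 ≤ (k + 1) * fixedRoot k) &&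
    reductionTest la lc 0 q &&
    reductionTests la lc (qs ++ List.replicate (69 - qs.length) q) 3
      (shiftWindow (shiftWindow (List.replicate (k - 1) 0 ++ [1])))

theorem orderTest_eq_true {k : ℕ} (hk : 3 ≤ k) (hk' : k ≤ 13) : orderTest k = true := by
  interval_cases k <;> decide +kernel

theorem atanhSum_bounds {a b : ℕ} (hb : 0 < b) (hab : 9 * a ≤ b) (n : ℕ) :
    ∀ (d T : ℕ) (t : ℝ), 1 ≤ d → (T : ℝ) ≤ t → t ≤ T + 2 →
      (atanhSum a b n d T : ℝ) ≤ ∑ j ∈ Finset.range n, t * ((a : ℝ) / b) ^ j / (d + 2 * j) ∧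
        ∑ j ∈ Finset.range n, t * ((a : ℝ) / b) ^ j / (d + 2 * j) ≤
          atanhSum a b n d T + 3 * n := by
  have hb' : (0 : ℝ) < b := by exact_mod_cast hb
  have hab' : (a : ℝ) / b ≤ 1 / 9 := by
    rw [div_le_div_iff₀ hb' (by norm_num)]
    have : (9 : ℝ) * a ≤ b := by exact_mod_cast hab
    linarith
  have ha0 : (0 : ℝ) ≤ (a : ℝ) / b := by positivity
  induction n with
  | zero => intro d T t _ _ _; simp [atanhSum]
  | succ n ih =>
    intro d T t hd hT ht
    have hd' : (1 : ℝ) ≤ d := by exact_mod_cast hd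
    have h1 : ((T * a / b : ℕ) : ℝ) ≤ t * ((a : ℝ) / b) := by
      refine Nat.cast_div_le.trans ?_
      push_cast
      rw [mul_div_assoc]
      gcongr
    have h2 : t * ((a : ℝ) / b) ≤ ((T * a / b : ℕ) : ℝ) + 2 := by
      have h3 : (T : ℝ) * (a / b) < ((T * a / b : ℕ) : ℝ) + 1 := by
        have := Nat.lt_div_mul_add (a := T * a) hb
        have h4 : ((T * a : ℕ) : ℝ) < ((T * a / b : ℕ) : ℝ) * b + b := by exact_mod_cast this
        rw [← mul_div_assoc, div_lt_iff₀ hb']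
        push_cast at h4 ⊢
        linarith
      nlinarith
    obtain ⟨l, u⟩ := ih (d + 2) (T * a / b) (t * ((a : ℝ) / b)) (by omega) h1 h2
    have e : ∑ j ∈ Finset.range (n + 1), t * ((a : ℝ) / b) ^ j / (d + 2 * j) =
        t / d + ∑ j ∈ Finset.range n,
          t * ((a : ℝ) / b) * ((a : ℝ) / b) ^ j / (((d + 2 : ℕ) : ℝ) + 2 * j) := by
      rw [Finset.sum_range_succ', add_comm]
      congr 1
      · simp
      · refine Finset.sum_congr rfl fun j _ => ?_
        push_cast
        congr 1 <;> ring
    have l' : ((T / d : ℕ) : ℝ) ≤ t / d := Nat.cast_div_le.trans (by gcongr)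
    have u' : t / d ≤ ((T / d : ℕ) : ℝ) + 3 := by
      have h4 : ((T : ℕ) : ℝ) < ((T / d : ℕ) : ℝ) * d + d := by
        exact_mod_cast Nat.lt_div_mul_add (a := T) (b := d) (by omega)
      rw [div_le_iff₀ (by linarith)]
      nlinarith
    rw [e, atanhSum]
    push_cast at l u l' u' ⊢
    constructor <;> linarith

theorem abs_atanhSum_sub_log_le {M P : ℕ} (hP : 0 < P) (hPM : P ≤ M) (hM : M ≤ 2 * P) :
    |(2 * atanhSum ((M - P) ^ 2) ((M + P) ^ 2) 31 1 (2 ^ 96 * (M - P) / (M + P)) : ℕ) -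
      2 ^ 96 * Real.log ((M : ℝ) / P)| ≤ 190 := by
  have hP' : (0 : ℝ) < P := by exact_mod_cast hP
  have hPM' : (P : ℝ) ≤ M := by exact_mod_cast hPM
  have hM' : (M : ℝ) ≤ 2 * P := by exact_mod_cast hM
  have hs : (0 : ℝ) < M + P := by linarith
  set z : ℝ := ((M : ℝ) - P) / (M + P) with hz
  have hz0 : 0 ≤ z := div_nonneg (by linarith) hs.le
  have hz1 : z ≤ 1 / 3 := by
    rw [hz, div_le_div_iff₀ hs (by norm_num)]; linarith
  have hquot : (1 + z) / (1 - z) = M / P := by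
    have h2 : 1 + z = 2 * M / (M + P) := by rw [hz]; field_simp; ring
    have h3 : 1 - z = 2 * P / (M + P) := by rw [hz]; field_simp; ring
    rw [h2, h3]; field_simp
  have hlo := Real.sum_range_le_log_div hz0 (by linarith) 31
  have hup := Real.log_div_le_sum_range_add hz0 (by linarith) 31
  rw [hquot] at hlo hup
  have hz2 : (((M - P) ^ 2 : ℕ) : ℝ) / ((M + P) ^ 2 : ℕ) = z ^ 2 := by
    rw [hz, div_pow]; push_cast [Nat.cast_sub hPM]; rfl
  have h9 : 9 * (M - P) ^ 2 ≤ (M + P) ^ 2 := by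
    have : 3 * (M - P) ≤ M + P := by omega
    calc 9 * (M - P) ^ 2 = (3 * (M - P)) ^ 2 := by ring
      _ ≤ _ := Nat.pow_le_pow_left this 2
  have hT : ((2 ^ 96 * (M - P) / (M + P) : ℕ) : ℝ) ≤ 2 ^ 96 * z := by
    refine Nat.cast_div_le.trans (le_of_eq ?_)
    rw [hz]; push_cast [Nat.cast_sub hPM]; ring
  have hT' : 2 ^ 96 * z ≤ ((2 ^ 96 * (M - P) / (M + P) : ℕ) : ℝ) + 2 := by
    have h4 : ((2 ^ 96 * (M - P) : ℕ) : ℝ) <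
        ((2 ^ 96 * (M - P) / (M + P) : ℕ) : ℝ) * (M + P : ℕ) + (M + P : ℕ) := by
      exact_mod_cast Nat.lt_div_mul_add (a := 2 ^ 96 * (M - P)) (b := M + P) (by omega)
    rw [hz, ← mul_div_assoc, div_le_iff₀ hs]
    push_cast [Nat.cast_sub hPM] at h4 ⊢
    linarith
  generalize 2 ^ 96 * (M - P) / (M + P) = T at hT hT' ⊢
  obtain ⟨l, u⟩ := atanhSum_bounds (a := (M - P) ^ 2) (b := (M + P) ^ 2) (by positivity) h9 31 1 T
    (2 ^ 96 * z) le_rfl hT hT'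
  have e : ∑ j ∈ Finset.range 31, 2 ^ 96 * z *
        ((((M - P) ^ 2 : ℕ) : ℝ) / ((M + P) ^ 2 : ℕ)) ^ j / (((1 : ℕ) : ℝ) + 2 * j) =
      2 ^ 96 * ∑ j ∈ Finset.range 31, z ^ (2 * j + 1) / (2 * j + 1) := by
    rw [Finset.mul_sum]
    refine Finset.sum_congr rfl fun j _ => ?_
    rw [hz2, ← pow_mul, pow_succ, Nat.cast_one, add_comm (1 : ℝ)]
    ring
  rw [e] at l u
  have htail : 2 ^ 96 * (z ^ (2 * 31 + 1) / (1 - z ^ 2)) ≤ 1 := by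
    have h1 : z ^ (2 * 31 + 1) ≤ (1 / 3) ^ (2 * 31 + 1) := pow_le_pow_left₀ hz0 hz1 _
    have h2 : z ^ 2 ≤ (1 / 3) ^ 2 := pow_le_pow_left₀ hz0 hz1 _
    rw [← mul_div_assoc, div_le_one (by linarith)]
    refine (mul_le_mul_of_nonneg_left h1 (by norm_num)).trans ?_
    norm_num at h2 ⊢
    linarith
  push_cast at l u ⊢
  rw [abs_le]
  constructor <;> linarith

theorem abs_fixedLogTwo_sub_le : |(fixedLogTwo : ℝ) - 2 ^ 96 * Real.log 2| ≤ 190 := by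
  have h := abs_atanhSum_sub_log_le (M := 2) (P := 1) one_pos (by norm_num) (by norm_num)
  have e : 2 * atanhSum ((2 - 1) ^ 2) ((2 + 1) ^ 2) 31 1 (2 ^ 96 * (2 - 1) / (2 + 1)) =
      fixedLogTwo := by decide +kernel
  rw [e] at h
  simpa using h

theorem abs_fixedLog_sub_le {N : ℕ} (hN : 0 < N) (hN' : N < 2 ^ 128) :
    |(fixedLog N : ℝ) - 2 ^ 96 * Real.log N| ≤ 2 ^ 15 := by
  set e := Nat.log2 N with he
  have he' : e < 128 := (Nat.log2_lt hN.ne').2 hN'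
  have hlow : 2 ^ e ≤ N := Nat.log2_self_le hN.ne'
  have hup : N < 2 ^ (e + 1) := Nat.lt_log2_self
  have h1 := abs_atanhSum_sub_log_le (M := N) (P := 2 ^ e) (by positivity) hlow
    (by rw [pow_succ] at hup; omega)
  have h2 := abs_fixedLogTwo_sub_le
  have hNr : (0 : ℝ) < N := by exact_mod_cast hN
  have hlog : Real.log ((N : ℝ) / ((2 ^ e : ℕ) : ℝ)) = Real.log N - e * Real.log 2 := by
    rw [Real.log_div hNr.ne' (by positivity)]
    push_cast
    rw [Real.log_pow]
  have he2 : (e : ℝ) ≤ 128 := by exact_mod_cast he'.le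
  have he0 : (0 : ℝ) ≤ e := by positivity
  rw [hlog] at h1
  rw [fixedLog, ← he]
  set s : ℕ := 2 * atanhSum ((N - 2 ^ e) ^ 2) ((N + 2 ^ e) ^ 2) 31 1
    (2 ^ 96 * (N - 2 ^ e) / (N + 2 ^ e))
  push_cast
  rw [abs_le] at *
  constructor <;> nlinarith

theorem abs_fixedLog_sub_scaled_le {N : ℕ} {v : ℝ} (hN : 2 ^ 95 ≤ N) (hN' : N < 2 ^ 101)
    (hv : (N : ℝ) ≤ 2 ^ 96 * v) (hv' : 2 ^ 96 * v ≤ N + 14) :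
    |(fixedLog N - 96 * fixedLogTwo : ℝ) - 2 ^ 96 * Real.log v| ≤ 2 ^ 17 := by
  have h1 := abs_fixedLog_sub_le (N := N) (by omega) (by omega)
  have h2 := abs_fixedLogTwo_sub_le
  have hN2 : (2 : ℝ) ^ 95 ≤ N := by exact_mod_cast hN
  have hN0 : (0 : ℝ) < N := by linarith
  have hv0 : 0 < v := by
    by_contra hcon
    push Not at hcon
    linarith [mul_nonpos_of_nonneg_of_nonpos (by norm_num : (0 : ℝ) ≤ 2 ^ 96) hcon]
  have h3 : Real.log N ≤ Real.log (2 ^ 96 * v) := Real.log_le_log hN0 hv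
  have h4 : Real.log (2 ^ 96 * v) ≤ Real.log N + 14 / 2 ^ 95 := by
    have h5 : Real.log (2 ^ 96 * v) - Real.log N ≤ 2 ^ 96 * v / N - 1 := by
      rw [← Real.log_div (by positivity) hN0.ne']
      exact Real.log_le_sub_one_of_pos (by positivity)
    have h6 : 2 ^ 96 * v / N - 1 ≤ 14 / 2 ^ 95 := by
      rw [div_sub_one hN0.ne']
      exact div_le_div₀ (by norm_num) (by linarith) (by norm_num) hN2
    linarith
  rw [Real.log_mul (by norm_num) hv0.ne', Real.log_pow] at h3 h4
  push_cast at h3 h4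
  rw [abs_le] at *
  constructor <;> nlinarith

theorem lt_abs_of_reductionTest {la lc R : ℝ} {la' lc' R' q : ℤ}
    (hla : |2 ^ 96 * la - la'| ≤ 2 ^ 40) (hlc : |2 ^ 96 * lc - lc'| ≤ 2 ^ 40)
    (hR : |2 ^ 96 * R - R'| ≤ 2 ^ 40) (h : reductionTest la' lc' R' q = true)
    {y : ℕ} (hy : 1 ≤ y) (hy' : y ≤ 850192) (v : ℤ) :
    2 / 10 ^ 11 < |y * (lc + R) + R - v * la| := by
  rw [reductionTest] at h
  generalize (2 * q * (lc' + R') + la') / (2 * la') = p at h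
  generalize (2 * q * R' + la') / (2 * la') = u at h
  simp only [reductionTestWith, Bool.and_eq_true, Bool.or_eq_true, decide_eq_true_eq] at h
  obtain ⟨⟨hq, hfar⟩, hnear⟩ := h
  set δ : ℤ := 2 * 2 ^ 96 / 10 ^ 11 + 1 with hδ
  by_contra! hcon
  have hq' : (0 : ℝ) < q := by exact_mod_cast hq
  have hyr : (y : ℝ) ≤ 850192 := by exact_mod_cast hy'
  have hδ' : (2 : ℝ) ^ 96 * (2 / 10 ^ 11) ≤ δ := by
    have : (2 * 2 ^ 96 : ℤ) ≤ δ * 10 ^ 11 := by rw [hδ]; norm_num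
    have h2 : (2 * 2 ^ 96 : ℝ) ≤ δ * 10 ^ 11 := by exact_mod_cast this
    rw [← mul_div_assoc, div_le_iff₀ (by norm_num)]
    linarith
  have hD : |2 ^ 96 * (q * (lc + R) - p * la)| ≤
      |((q * (lc' + R') - p * la' : ℤ) : ℝ)| + ((2 * q + |p| : ℤ) : ℝ) * 2 ^ 40 := by
    have e : 2 ^ 96 * (q * (lc + R) - p * la) = ((q * (lc' + R') - p * la' : ℤ) : ℝ) +
        (q * (2 ^ 96 * lc - lc') + q * (2 ^ 96 * R - R') - p * (2 ^ 96 * la - la')) := by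
      push_cast; ring
    have b : |q * (2 ^ 96 * lc - lc') + q * (2 ^ 96 * R - R') - p * (2 ^ 96 * la - la')| ≤
        q * 2 ^ 40 + q * 2 ^ 40 + |(p : ℝ)| * 2 ^ 40 := by
      refine (abs_sub _ _).trans (add_le_add ((abs_add_le _ _).trans ?_) ?_)
      · rw [abs_mul, abs_mul, abs_of_pos hq']; gcongr
      · rw [abs_mul]; gcongr
    rw [e]
    refine (abs_add_le _ _).trans ?_
    push_cast at b ⊢
    linarith
  have hr : |2 ^ 96 * (q * R - u * la) - (q * R' - u * la' : ℤ)| ≤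
      ((q + |u| : ℤ) : ℝ) * 2 ^ 40 := by
    have e : 2 ^ 96 * (q * R - u * la) - (q * R' - u * la' : ℤ) =
        q * (2 ^ 96 * R - R') - u * (2 ^ 96 * la - la') := by push_cast; ring
    rw [e]
    refine (abs_sub _ _).trans ?_
    rw [abs_mul, abs_mul, abs_of_pos hq']
    push_cast
    rw [add_mul]
    gcongr
  set D : ℝ := q * (lc + R) - p * la with hDdef
  set D' : ℤ := q * (lc' + R') - p * la'
  set r : ℝ := q * R - u * la with hrdef
  set r' : ℤ := q * R' - u * la'
  set t : ℤ := y * p - q * v with ht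
  have key : (2 : ℝ) ^ 96 * ((t + u) * la + r) =
      q * (2 ^ 96 * (y * (lc + R) + R - v * la)) - y * (2 ^ 96 * D) := by
    rw [hDdef, hrdef, ht]; push_cast; ring
  have hbound : |(2 : ℝ) ^ 96 * ((t + u) * la + r)| ≤
      q * δ + 850192 * (|(D' : ℝ)| + (2 * q + |(p : ℝ)|) * 2 ^ 40) := by
    rw [key]
    refine (abs_sub _ _).trans (add_le_add ?_ ?_)
    · rw [abs_mul, abs_of_pos hq', abs_mul, abs_of_pos (by norm_num : (0 : ℝ) < 2 ^ 96)]
      gcongr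
      exact (mul_le_mul_of_nonneg_left hcon (by norm_num)).trans hδ'
    · rw [abs_mul, Nat.abs_cast]
      push_cast at hD
      gcongr
  have hfar' : |(r' : ℝ)| + (q + |(u : ℝ)|) * 2 ^ 40 +
      (q * δ + 850192 * (|(D' : ℝ)| + (2 * q + |(p : ℝ)|) * 2 ^ 40)) < la' - 2 ^ 40 := by
    exact_mod_cast hfar
  push_cast at hr
  by_cases htu : t + u = 0
  · have htu' : (t : ℝ) + u = 0 := by exact_mod_cast htu
    rw [htu', zero_mul, zero_add] at hbound
    rcases hnear with hnear | ⟨⟨hu, hlarge⟩, hgcd⟩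
    · have hnear' : (q + |(u : ℝ)|) * 2 ^ 40 +
          (q * δ + 850192 * (|(D' : ℝ)| + (2 * q + |(p : ℝ)|) * 2 ^ 40)) < |(r' : ℝ)| := by
        exact_mod_cast hnear
      have h1 := abs_sub_abs_le_abs_sub (r' : ℝ) (2 ^ 96 * r)
      rw [abs_sub_comm] at h1
      linarith
    · have hdvd : q ∣ p * y := ⟨v, by rw [hu] at htu; linarith⟩
      have hcop : IsCoprime q p := (Int.isCoprime_iff_gcd_eq_one.2 hgcd).symm
      have := Int.le_of_dvd (by omega) (hcop.dvd_of_dvd_mul_left hdvd)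
      omega
  · have h1 : (1 : ℝ) ≤ |(t : ℝ) + u| := by exact_mod_cast Int.one_le_abs htu
    have hla1 : (la' : ℝ) - 2 ^ 40 ≤ 2 ^ 96 * la := by linarith [(abs_le.1 hla).1]
    have hla0 : 0 < 2 ^ 96 * la := by
      have : 0 ≤ |(r' : ℝ)| + (q + |(u : ℝ)|) * 2 ^ 40 := by positivity
      have h9 := (abs_nonneg _).trans hbound
      linarith
    have h2 : 2 ^ 96 * la ≤ |((t : ℝ) + u) * (2 ^ 96 * la)| := by
      rw [abs_mul, abs_of_pos hla0]
      exact le_mul_of_one_le_left hla0.le h1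
    have e : ((t : ℝ) + u) * (2 ^ 96 * la) =
        2 ^ 96 * ((t + u) * la + r) - (2 ^ 96 * r - r') - r' := by ring
    have h3 : |((t : ℝ) + u) * (2 ^ 96 * la)| ≤
        |2 ^ 96 * ((t + u) * la + r)| + |2 ^ 96 * r - r'| + |(r' : ℝ)| := by
      rw [e]
      exact (abs_sub _ _).trans (add_le_add (abs_sub _ _) le_rfl)
    linarith

section Asymptotics

variable {α : ℝ} {k : ℕ}

theorem sum_range_pow_of_root (hα : 1 < α) (hroot : α ^ k * (2 - α) = 1) :
    ∑ j ∈ Finset.range k, α ^ j = α ^ k := by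
  rw [geom_sum_eq hα.ne', div_eq_iff (by linarith)]
  linarith

theorem weighted_sum_succ (g : ℕ → ℝ) (b : ℕ → ℝ) (hb0 : b 0 = 0) (hbk : b k = 1) (i : ℕ) :
    ∑ j ∈ Finset.range k, b (j + 1) * g (i + 1 + j) =
      (∑ j ∈ Finset.range k, b j * g (i + j)) + g (i + k) := by
  have h1 := Finset.sum_range_succ (fun j => b j * g (i + j)) k
  have h2 := Finset.sum_range_succ' (fun j => b j * g (i + j)) k
  rw [h1, hb0, hbk, zero_mul, one_mul, add_zero] at h2
  rw [h2]
  exact Finset.sum_congr rfl fun j _ => by rw [add_assoc, add_comm 1 j]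

theorem root_denominator_pos (hα : 1 < α) (hk : 1 ≤ k) (hroot : α ^ k * (2 - α) = 1) :
    0 < α - k * (2 - α) := by
  have hα0 : 0 < α := by linarith
  have h2 : 0 < 2 - α := by
    by_contra hcon
    nlinarith [pow_pos hα0 k, mul_nonpos_of_nonneg_of_nonpos (pow_pos hα0 k).le (not_lt.1 hcon)]
  have h1 : (k : ℝ) < ∑ j ∈ Finset.range k, α ^ (j + 1) := by
    calc (k : ℝ) = ∑ j ∈ Finset.range k, (1 : ℝ) := by simp
      _ < _ := Finset.sum_lt_sum_of_nonempty (by simpa using by omega)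
        fun j _ => one_lt_pow₀ hα (by omega)
  have h3 : ∑ j ∈ Finset.range k, α ^ (j + 1) = α * α ^ k := by
    simp_rw [pow_succ']
    rw [← Finset.mul_sum, sum_range_pow_of_root hα hroot]
  rw [h3] at h1
  nlinarith

/-- The Dresden–Du type estimate: a generalized Fibonacci sequence stays within `1` of its dominant
term. -/
theorem abs_sub_dominant_le_one (hα : 1 < α) (hk : 1 ≤ k) (hroot : α ^ k * (2 - α) = 1)
    {f : ℕ → ℝ} (h0 : ∀ i, i + 1 < k → f i = 0) (h1 : f (k - 1) = 1)
    (hrec : ∀ i, f (i + k) = ∑ j ∈ Finset.range k, f (i + j)) (n : ℕ) :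
    |f (n + (k - 1)) - (α - 1) / (α - k * (2 - α)) * α ^ n| ≤ 1 := by
  obtain ⟨l, rfl⟩ : ∃ l, k = l + 1 := ⟨k - 1, by omega⟩
  have hα0 : 0 < α := by linarith
  have hα1 : 0 < α - 1 := by linarith
  have hden := root_denominator_pos hα hk hroot
  set k := l + 1 with hkl
  have hl : k - 1 = l := by omega
  rw [hl] at h1 ⊢
  set b : ℕ → ℝ := fun j => (1 - α⁻¹ ^ j) / (α - 1) with hb
  have hb0 : b 0 = 0 := by simp [hb]
  have hinv : α⁻¹ ^ k = 2 - α := by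
    rw [inv_pow]; exact inv_eq_of_mul_eq_one_right hroot
  have hbk : b k = 1 := by
    simp only [hb, hinv]
    rw [div_eq_one_iff_eq hα1.ne']; ring
  have hbdiff : ∀ j, b (j + 1) - b j = α⁻¹ ^ (j + 1) := by
    intro j
    simp only [hb, pow_succ]
    field_simp
    ring
  have hbmul : ∀ j, α * b (j + 1) = b j + 1 := by
    intro j
    simp only [hb, pow_succ]
    field_simp
    ring
  have hbnonneg : ∀ j, 0 ≤ b j := fun j =>
    div_nonneg (sub_nonneg.2 (pow_le_one₀ (by positivity) (inv_le_one_of_one_le₀ hα.le))) hα1.le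
  -- the weighted sum of the sequence is a pure power of `α`
  have hW : ∀ i, ∑ j ∈ Finset.range k, b (j + 1) * f (i + j) = α ^ i := by
    intro i
    induction i with
    | zero =>
      rw [hkl, Finset.sum_range_succ, Finset.sum_eq_zero, ← hkl, hbk, zero_add, zero_add, h1]
      · simp
      · intro j hj
        rw [h0 _ (by have := Finset.mem_range.1 hj; omega), mul_zero]
    | succ i ih =>
      rw [weighted_sum_succ f b hb0 hbk, hrec, ← Finset.sum_add_distrib, pow_succ', ← ih,
        Finset.mul_sum]
      refine Finset.sum_congr rfl fun j _ => ?_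
      rw [← mul_assoc, hbmul]; ring
  set s : ℝ := ∑ j ∈ Finset.range k, b (j + 1) * α ^ j with hs
  have hsval : s = α ^ l * ((α - k * (2 - α)) / (α - 1)) := by
    have h3 : ∀ j, b (j + 1) * α ^ j = (α ^ j - α⁻¹) / (α - 1) := by
      intro j
      simp only [hb, pow_succ, inv_pow]
      field_simp
    have h4 : α ^ k = α ^ l * α := by rw [hkl, pow_succ]
    have h5 : α⁻¹ = α ^ l * (2 - α) := by
      rw [inv_eq_iff_eq_inv]
      refine eq_inv_of_mul_eq_one_left ?_
      rw [← hroot, h4]; ring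
    rw [hs, Finset.sum_congr rfl fun j _ => h3 j, ← Finset.sum_div, Finset.sum_sub_distrib,
      sum_range_pow_of_root hα hroot, Finset.sum_const, Finset.card_range, nsmul_eq_mul, h4, h5]
    ring
  have hspos : 0 < s := by rw [hsval]; positivity
  set E : ℕ → ℝ := fun i => f i - α ^ i / s with hE
  have hWE : ∀ i, ∑ j ∈ Finset.range k, b (j + 1) * E (i + j) = 0 := by
    intro i
    have h3 : ∀ j, b (j + 1) * E (i + j) =
        b (j + 1) * f (i + j) - α ^ i / s * (b (j + 1) * α ^ j) := by
      intro j; simp only [hE, pow_add]; ring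
    rw [Finset.sum_congr rfl fun j _ => h3 j, Finset.sum_sub_distrib, hW, ← Finset.mul_sum, ← hs,
      div_mul_cancel₀ _ hspos.ne', sub_self]
  have hErec : ∀ i, E (i + k) = ∑ j ∈ Finset.range k, (b (j + 1) - b j) * E (i + j) := by
    intro i
    have h3 := weighted_sum_succ E b hb0 hbk i
    rw [hWE] at h3
    simp_rw [sub_mul]
    rw [Finset.sum_sub_distrib, hWE]
    linarith
  have hweights : ∑ j ∈ Finset.range k, (b (j + 1) - b j) = 1 := by
    rw [Finset.sum_range_sub, hbk, hb0, sub_zero]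
  have hsmall : ∀ i < k, 0 < α ^ i / s ∧ α ^ i / s ≤ 1 := by
    intro i hi
    refine ⟨by positivity, (div_le_one hspos).2 ?_⟩
    calc α ^ i ≤ α ^ l := pow_le_pow_right₀ hα.le (by omega)
      _ = b (l + 1) * α ^ l := by rw [← hkl, hbk, one_mul]
      _ ≤ s := Finset.single_le_sum (f := fun j => b (j + 1) * α ^ j)
        (fun j _ => mul_nonneg (hbnonneg _) (by positivity)) (Finset.mem_range.2 (by omega))
  have hEle : ∀ i, |E i| ≤ 1 := by
    intro i
    induction i using Nat.strong_induction_on with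
    | _ i ih =>
      rcases lt_or_ge i k with hi | hi
      · obtain ⟨h3, h4⟩ := hsmall i hi
        rcases eq_or_ne i l with rfl | hil
        · simp only [hE, h1]
          rw [abs_le]; constructor <;> linarith
        · simp only [hE]
          rw [h0 i (by omega), abs_le]; constructor <;> linarith
      · obtain ⟨i, rfl⟩ := Nat.exists_eq_add_of_le' hi
        rw [hErec, ← hweights]
        refine (Finset.abs_sum_le_sum_abs _ _).trans (Finset.sum_le_sum fun j hj => ?_)
        have hpos : 0 ≤ b (j + 1) - b j := by rw [hbdiff]; positivity
        rw [abs_mul, abs_of_nonneg hpos]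
        exact mul_le_of_le_one_right hpos (ih _ (by have := Finset.mem_range.1 hj; omega))
  have hfin : (α - 1) / (α - k * (2 - α)) * α ^ n = α ^ (n + l) / s := by
    rw [hsval, pow_add]
    field_simp
  rw [hfin]
  exact hEle _

end Asymptotics

theorem abs_log_le_of_abs_sub_one_le {u δ : ℝ} (hδ : δ < 1) (hu : |u - 1| ≤ δ) :
    |Real.log u| ≤ δ / (1 - δ) := by
  obtain ⟨h1, h2⟩ := abs_le.1 hu
  have hu0 : 0 < u := by linarith
  have hδ0 : 0 ≤ δ := (abs_nonneg _).trans hu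
  have h3 : δ ≤ δ / (1 - δ) := by rw [le_div_iff₀ (by linarith)]; nlinarith
  rw [abs_le]
  constructor
  · refine le_trans ?_ (Real.one_sub_inv_le_log_of_pos hu0)
    have h4 : u⁻¹ ≤ (1 - δ)⁻¹ := inv_anti₀ (by linarith) (by linarith)
    have h5 : δ / (1 - δ) = (1 - δ)⁻¹ - 1 := by
      have : 1 - δ ≠ 0 := by linarith
      field_simp
      ring
    linarith
  · exact (Real.log_le_sub_one_of_pos hu0).trans (by linarith)

/-- `w` lists the `k` consecutive values of `F` starting at `i`. -/
def IsWindow (F : ℤ → ℤ) (k : ℕ) (i : ℤ) (w : List ℕ) : Prop :=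
  w.map (fun a : ℕ => (a : ℤ)) = (List.range k).map fun j : ℕ => F (i + j)

theorem IsWindow.sum_eq {F : ℤ → ℤ} {k : ℕ} {i : ℤ} {w : List ℕ} (h : IsWindow F k i w) :
    (w.sum : ℤ) = ∑ j ∈ Finset.range k, F (i + j) := by
  rw [Nat.cast_list_sum]
  change (w.map fun a : ℕ => (a : ℤ)).sum = _
  rw [h]
  simp [Finset.sum, Multiset.range]

theorem IsWindow.shiftWindow {F : ℤ → ℤ} {k : ℕ} {i : ℤ} {w : List ℕ} (h : IsWindow F k i w)
    (hk : 1 ≤ k) (hrec : F (i + k) = ∑ j ∈ Finset.range k, F (i + j)) :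
    IsWindow F k (i + 1) (shiftWindow w) := by
  have hs := h.sum_eq
  obtain ⟨l, rfl⟩ : ∃ l, k = l + 1 := ⟨k - 1, by omega⟩
  have ht : (List.range (l + 1)).tail = (List.range l).map Nat.succ := by
    rw [List.range_succ_eq_map, List.tail_cons]
  rw [IsWindow, _root_.shiftWindow, List.map_append, List.map_tail, h, List.map_singleton, hs,
    ← hrec, ← List.map_tail, ht, List.map_map, List.range_succ (n := l), List.map_append,
    List.map_singleton]
  congr 1
  · refine List.map_congr_left fun j _ => congrArg F ?_
    rw [Nat.cast_succ, add_assoc, add_comm (j : ℤ)]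
  · rw [Nat.cast_succ, add_assoc, add_comm (l : ℤ)]

theorem isWindow_iterate {F : ℤ → ℤ} {k : ℕ} {i : ℤ} {w : List ℕ} (h : IsWindow F k i w)
    (hk : 1 ≤ k) (hrec : ∀ i' ≥ i, F (i' + k) = ∑ j ∈ Finset.range k, F (i' + j)) (n : ℕ) :
    IsWindow F k (i + n) (shiftWindow^[n] w) := by
  induction n with
  | zero => simpa using h
  | succ n ih =>
    rw [Function.iterate_succ_apply']
    have := ih.shiftWindow hk (hrec _ (by omega))
    push_cast
    rwa [← add_assoc]

theorem reductionTest_of_reductionTests {la lc : ℤ} (qs : List ℕ) :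
    ∀ (m : ℕ) (w : List ℕ), reductionTests la lc qs m w = true → ∀ j < qs.length,
      ∃ q : ℕ, reductionTest la lc
        (fixedLog (shiftWindow^[j] w).sum - lc - (m + j : ℕ) * la) q = true := by
  induction qs with
  | nil => intro m w _ j hj; simp at hj
  | cons q qs ih =>
    intro m w h j hj
    rw [reductionTests, Bool.and_eq_true] at h
    cases j with
    | zero => exact ⟨q, h.1⟩
    | succ j =>
      obtain ⟨q', hq'⟩ := ih (m + 1) (shiftWindow w) h.2 j (by simpa using hj)
      refine ⟨q', ?_⟩
      rwa [Function.iterate_succ_apply, show m + (j + 1) = m + 1 + j by ring]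

theorem length_append_replicate_sub {β : Type*} (l : List β) (a : β) (n : ℕ) :
    n ≤ (l ++ List.replicate (n - l.length) a).length := by
  simp; omega

/-- The numerical data attached to the order `k`: the dominant root with its fixed-point
logarithms, and the outcome of the tests. -/
theorem exists_dominant_root {k : ℕ} (hk : 3 ≤ k) (hk' : k ≤ 13) :
    ∃ α : ℝ, 9 / 5 ≤ α ∧ α < 2 ∧ α ^ k * (2 - α) = 1 ∧
      |2 ^ 96 * Real.log α - fixedLogRoot k| ≤ 2 ^ 17 ∧
      |2 ^ 96 * Real.log ((α - 1) / (α - k * (2 - α))) - fixedLogCoeff k| ≤ 2 ^ 18 ∧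
      (∃ q : ℕ, reductionTest (fixedLogRoot k) (fixedLogCoeff k) 0 q = true) ∧
      ∀ j < 69, ∃ q : ℕ, reductionTest (fixedLogRoot k) (fixedLogCoeff k)
        (fixedLog (shiftWindow^[j + 2] (List.replicate (k - 1) 0 ++ [1])).sum - fixedLogCoeff k
          - (3 + j : ℕ) * fixedLogRoot k) q = true := by
  have h := orderTest_eq_true hk hk'
  simp only [orderTest, Bool.and_eq_true, decide_eq_true_eq] at h
  obtain ⟨⟨⟨⟨⟨⟨hlo, hhi⟩, h95⟩, h2⟩, hden⟩, hq⟩, hqs⟩ := h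
  have hrl : fixedLogRoot k = fixedLog (fixedRoot k) - 96 * fixedLogTwo := rfl
  have hcl : fixedLogCoeff k = fixedLog (fixedRoot k - 2 ^ 96) -
    fixedLog ((k + 1) * fixedRoot k - 2 * k * 2 ^ 96) := rfl
  generalize fixedLogRoot k = la at *
  generalize fixedLogCoeff k = lc at *
  generalize fixedRoot k = N at *
  have hS : (0 : ℝ) < 2 ^ 96 := by norm_num
  have hcont : ContinuousOn (fun x : ℝ => x ^ k * (2 - x))
      (Set.Icc ((N : ℝ) / 2 ^ 96) (((N : ℝ) + 1) / 2 ^ 96)) := by fun_prop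
  have hscale : ∀ M : ℕ, M ≤ 2 * 2 ^ 96 → ((M ^ k * (2 * 2 ^ 96 - M) : ℕ) : ℝ) =
      ((M : ℝ) / 2 ^ 96) ^ k * (2 - (M : ℝ) / 2 ^ 96) * ((2 ^ (96 * (k + 1)) : ℕ) : ℝ) := by
    intro M hM
    rw [Nat.cast_mul, Nat.cast_sub hM, Nat.cast_pow, Nat.cast_pow, Nat.cast_mul, Nat.cast_pow,
      Nat.cast_ofNat, pow_mul, pow_succ ((2 : ℝ) ^ 96) k, div_pow]
    field_simp
  have hP : (0 : ℝ) < ((2 ^ (96 * (k + 1)) : ℕ) : ℝ) := by positivity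
  replace hlo := (Nat.cast_lt (α := ℝ)).2 hlo
  replace hhi := (Nat.cast_lt (α := ℝ)).2 hhi
  rw [hscale N (by omega)] at hlo
  rw [hscale (N + 1) (by omega)] at hhi
  rw [Nat.cast_add, Nat.cast_one] at hhi
  have hlo' : 1 ≤ ((N : ℝ) / 2 ^ 96) ^ k * (2 - (N : ℝ) / 2 ^ 96) :=
    le_of_mul_le_mul_right (by rw [one_mul]; exact hlo.le) hP
  have hhi' : (((N : ℝ) + 1) / 2 ^ 96) ^ k * (2 - ((N : ℝ) + 1) / 2 ^ 96) ≤ 1 :=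
    le_of_mul_le_mul_right (by rw [one_mul]; exact hhi.le) hP
  clear hscale hlo hhi hP
  obtain ⟨α, ⟨hα1, hα2⟩, hroot⟩ := intermediate_value_Icc' (by gcongr; linarith) hcont
    (Set.mem_Icc.2 ⟨hhi', hlo'⟩)
  simp only at hroot
  rw [div_le_iff₀' hS] at hα1
  rw [le_div_iff₀' hS] at hα2
  have h95' : (9 : ℝ) * 2 ^ 96 ≤ 5 * N := by exact_mod_cast h95
  have h2' : (N : ℝ) + 1 < 2 * 2 ^ 96 := by exact_mod_cast h2
  have hk13 : (k : ℝ) ≤ 13 := by exact_mod_cast hk'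
  have hα95 : 9 / 5 ≤ α := by linarith
  have hdenpos := root_denominator_pos (by linarith) (by omega) hroot
  have hNS : 2 ^ 96 ≤ N := by omega
  have e1 := abs_fixedLog_sub_scaled_le (N := N) (v := α) (by omega) (by omega) hα1 (by linarith)
  have hden' : 2 * k * 2 ^ 96 ≤ (k + 1) * N := le_of_add_le_left hden
  have hM : (((k + 1) * N : ℕ) : ℝ) = (k + 1) * N := by
    rw [Nat.cast_mul, Nat.cast_succ]
  have hM14 : (k + 1) * N ≤ 14 * (2 * 2 ^ 96) := Nat.mul_le_mul (by omega) (by omega)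
  have hsub1 : ((N - 2 ^ 96 : ℕ) : ℝ) = N - 2 ^ 96 := by
    rw [Nat.cast_sub hNS, Nat.cast_pow, Nat.cast_ofNat]
  have hsub2 : (((k + 1) * N - 2 * k * 2 ^ 96 : ℕ) : ℝ) = (k + 1) * N - 2 * k * 2 ^ 96 := by
    rw [Nat.cast_sub hden', hM, Nat.cast_mul, Nat.cast_mul, Nat.cast_pow, Nat.cast_ofNat]
  have e2 := abs_fixedLog_sub_scaled_le (N := N - 2 ^ 96) (v := α - 1) (by omega) (by omega)
    (by rw [hsub1]; linarith) (by rw [hsub1]; linarith)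
  have hk0 : (0 : ℝ) ≤ k + 1 := by positivity
  have hk1 := mul_le_mul_of_nonneg_left hα1 hk0
  have hk2 := mul_le_mul_of_nonneg_left hα2 hk0
  have hv : (2 : ℝ) ^ 96 * (α - k * (2 - α)) = (k + 1) * (2 ^ 96 * α) - 2 * k * 2 ^ 96 := by ring
  have e3 := abs_fixedLog_sub_scaled_le (N := (k + 1) * N - 2 * k * 2 ^ 96)
    (v := α - k * (2 - α)) (by omega) (by omega)
    (by rw [hsub2, hv]; linarith) (by rw [hsub2, hv]; linarith)
  refine ⟨α, hα95, by linarith, hroot, ?_, ?_, ⟨_, hq⟩, fun j hj => ?_⟩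
  · rw [abs_sub_comm, hrl]; push_cast; exact e1
  · rw [Real.log_div (by linarith) hdenpos.ne', hcl, Int.cast_sub, Int.cast_natCast,
      Int.cast_natCast]
    rw [abs_le] at *
    constructor <;> linarith
  · exact reductionTest_of_reductionTests _ 3 _ hqs j
      (hj.trans_le (length_append_replicate_sub _ _ _))

theorem sum_Icc_sub_eq_sum_range (k : ℕ) (F : ℤ → ℤ) (i : ℤ) :
    ∑ j ∈ Finset.Icc (1 : ℤ) k, F (i + k - j) = ∑ j ∈ Finset.range k, F (i + j) := by
  refine Finset.sum_bij' (fun j _ => (k - j).toNat) (fun j _ => (k : ℤ) - j) ?_ ?_ ?_ ?_ ?_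
  · intro j hj; simp only [Finset.mem_Icc, Finset.mem_range] at *; omega
  · intro j hj; simp only [Finset.mem_Icc, Finset.mem_range] at *; omega
  · intro j hj; simp only [Finset.mem_Icc] at *; omega
  · intro j hj; simp
  · intro j hj
    simp only [Finset.mem_Icc] at hj
    congr 1
    omega

/-- `F` is the `k`-generalized Fibonacci sequence. -/
structure IsGeneralizedFib (k : ℕ) (F : ℤ → ℤ) : Prop where
  eq_zero : ∀ i : ℤ, 2 - (k : ℤ) ≤ i → i ≤ 0 → F i = 0
  eq_one : F 1 = 1
  recurrence : ∀ i ≥ 2 - (k : ℤ), F (i + k) = ∑ j ∈ Finset.range k, F (i + j)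

namespace IsGeneralizedFib

variable {k : ℕ} {F : ℤ → ℤ}

theorem nonneg (h : IsGeneralizedFib k F) {i : ℤ} (hi : 2 - (k : ℤ) ≤ i) : 0 ≤ F i := by
  obtain ⟨n, rfl⟩ : ∃ n : ℕ, i = 2 - k + n := ⟨(i - (2 - k)).toNat, by omega⟩
  induction n using Nat.strong_induction_on with
  | _ n ih =>
    rcases lt_or_ge n k with hn | hn
    · rcases eq_or_ne (2 - (k : ℤ) + n) 1 with h1 | h1
      · rw [h1, h.eq_one]; exact zero_le_one
      · rw [h.eq_zero _ hi (by omega)]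
    · have := h.recurrence (2 - k + (n - k : ℕ)) (by omega)
      rw [show (2 - (k : ℤ) + (n - k : ℕ) + k) = 2 - k + n by omega] at this
      rw [this]
      refine Finset.sum_nonneg fun j hj => ?_
      have hj' := Finset.mem_range.1 hj
      have := ih (n - k + j) (by omega) (by omega)
      rwa [Nat.cast_add, ← add_assoc] at this

theorem add_three_le (h : IsGeneralizedFib k F) (hk : 3 ≤ k) {i : ℤ} (hi : 2 ≤ i) :
    F (i - 1) + F (i - 2) + F (i - 3) ≤ F i := by
  obtain ⟨l, rfl⟩ : ∃ l, k = l + 3 := ⟨k - 3, by omega⟩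
  have h1 := h.recurrence (i - (l + 3 : ℕ)) (by omega)
  rw [sub_add_cancel, Finset.sum_range_succ, Finset.sum_range_succ, Finset.sum_range_succ] at h1
  have h2 : 0 ≤ ∑ j ∈ Finset.range l, F (i - (l + 3 : ℕ) + j) :=
    Finset.sum_nonneg fun j _ => h.nonneg (by omega)
  rw [show i - ((l + 3 : ℕ) : ℤ) + (l : ℕ) = i - 3 by omega,
    show i - ((l + 3 : ℕ) : ℤ) + (l + 1 : ℕ) = i - 2 by omega,
    show i - ((l + 3 : ℕ) : ℤ) + (l + 2 : ℕ) = i - 1 by omega] at h1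
  linarith

theorem eq_one_two (h : IsGeneralizedFib k F) (hk : 3 ≤ k) : F 2 = 1 := by
  have h1 := h.recurrence (2 - k) le_rfl
  obtain ⟨l, rfl⟩ : ∃ l, k = l + 1 := ⟨k - 1, by omega⟩
  rwa [sub_add_cancel, Finset.sum_range_succ, Finset.sum_eq_zero fun j hj => h.eq_zero _ (by omega)
    (by have := Finset.mem_range.1 hj; omega),
    show (2 : ℤ) - (l + 1 : ℕ) + l = 1 by omega, h.eq_one, zero_add] at h1

theorem succ_le_two_mul (h : IsGeneralizedFib k F) (hk : 3 ≤ k) {i : ℤ} (hi : 1 ≤ i) :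
    F (i + 1) ≤ 2 * F i := by
  rcases eq_or_lt_of_le hi with rfl | hi
  · rw [h.eq_one, one_add_one_eq_two, h.eq_one_two hk]
    norm_num
  · have h1 := h.recurrence (i - k) (by omega)
    have h2 := h.recurrence (i - k + 1) (by omega)
    have h3 := Finset.sum_range_succ (fun j : ℕ => F (i - k + j)) k
    have h4 := Finset.sum_range_succ' (fun j : ℕ => F (i - k + j)) k
    have h5 : ∑ j ∈ Finset.range k, F (i - k + 1 + j) =
        ∑ j ∈ Finset.range k, F (i - k + (j + 1 : ℕ)) :=
      Finset.sum_congr rfl fun j _ => by congr 1; omega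
    have h6 := h.nonneg (i := i - k) (by omega)
    rw [show i - (k : ℤ) + 1 + k = i + 1 by ring, h5] at h2
    rw [sub_add_cancel] at h1 h3
    simp only [Nat.cast_zero, add_zero] at h4
    linarith

theorem one_le (h : IsGeneralizedFib k F) (hk : 3 ≤ k) {i : ℤ} (hi : 1 ≤ i) : 1 ≤ F i := by
  induction i, hi using Int.leInduction with
  | base => exact h.eq_one.ge
  | succ i hi ih =>
    have h1 := h.add_three_le hk (i := i + 1) (by omega)
    have h2 := h.nonneg (i := i + 1 - 2) (by omega)
    have h3 := h.nonneg (i := i + 1 - 3) (by omega)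
    rw [add_sub_cancel_right] at h1
    linarith

theorem le_two_pow (h : IsGeneralizedFib k F) (hk : 3 ≤ k) (n : ℕ) : F (n + 1) ≤ 2 ^ n := by
  induction n with
  | zero => simp [h.eq_one]
  | succ n ih =>
    have := h.succ_le_two_mul hk (i := n + 1) (by omega)
    push_cast
    rw [pow_succ]
    linarith

theorem ratio_le (h : IsGeneralizedFib k F) (hk : 3 ≤ k) {m : ℤ} (hm : 3 ≤ m) :
    4 ≤ F (m + 1) ∧ 13 * F (m - 1) ≤ 4 * F (m + 1) := by
  have h1 := h.add_three_le hk (i := m + 1) (by omega)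
  have h2 := h.add_three_le hk (i := m) (by omega)
  have h3 := h.nonneg (i := m - 3) (by omega)
  have h4 := h.one_le hk (i := m - 1) (by omega)
  have h5 := h.one_le hk (i := m - 2) (by omega)
  have h6 := h.succ_le_two_mul hk (i := m - 2) (by omega)
  rw [add_sub_cancel_right, show m + 1 - 2 = m - 1 by ring, show m + 1 - 3 = m - 2 by ring] at h1
  rw [show m - 2 + 1 = m - 1 by ring] at h6
  refine ⟨by linarith, ?_⟩
  rcases eq_or_lt_of_le hm with rfl | hm
  · norm_num [h.eq_one, h.eq_one_two hk] at *
    linarith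
  · have h7 := h.succ_le_two_mul hk (i := m - 3) (by omega)
    rw [show m - 3 + 1 = m - 2 by ring] at h7
    linarith

theorem abs_sub_dominant_le_one (h : IsGeneralizedFib k F) (hk : 3 ≤ k) {α : ℝ} (hα : 1 < α)
    (hroot : α ^ k * (2 - α) = 1) (n : ℕ) :
    |(F (n + 1) : ℝ) - (α - 1) / (α - k * (2 - α)) * α ^ n| ≤ 1 := by
  have := _root_.abs_sub_dominant_le_one hα (by omega) hroot
    (f := fun i : ℕ => (F (2 - k + i) : ℝ))
    (fun i hi => by rw [h.eq_zero _ (by omega) (by omega), Int.cast_zero])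
    (by rw [show (2 : ℤ) - k + (k - 1 : ℕ) = 1 by omega, h.eq_one, Int.cast_one])
    (fun i => by
      have := h.recurrence (2 - k + i) (by omega)
      rw [Nat.cast_add, ← add_assoc, this, Int.cast_sum]
      exact Finset.sum_congr rfl fun j _ => by rw [Nat.cast_add, ← add_assoc]) n
  rwa [show (2 : ℤ) - k + (n + (k - 1) : ℕ) = n + 1 by omega] at this

theorem isWindow_zero (h : IsGeneralizedFib k F) (hk : 3 ≤ k) :
    IsWindow F k (2 - k) (List.replicate (k - 1) 0 ++ [1]) := by
  obtain ⟨l, rfl⟩ : ∃ l, k = l + 1 := ⟨k - 1, by omega⟩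
  rw [IsWindow, List.range_succ, List.map_append, List.map_append, List.map_replicate,
    List.map_singleton, List.map_singleton, show (2 : ℤ) - (l + 1 : ℕ) + l = 1 by omega, h.eq_one]
  congr 1
  symm
  rw [List.eq_replicate_iff]
  refine ⟨by simp, fun b hb => ?_⟩
  obtain ⟨j, hj, rfl⟩ := List.mem_map.1 hb
  have := List.mem_range.1 hj
  exact h.eq_zero _ (by omega) (by omega)

theorem sum_iterate_shiftWindow (h : IsGeneralizedFib k F) (hk : 3 ≤ k) (n : ℕ) :
    ((shiftWindow^[n] (List.replicate (k - 1) 0 ++ [1])).sum : ℤ) = F (n + 2) := by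
  have h1 := isWindow_iterate (h.isWindow_zero hk) (by omega) h.recurrence n
  rw [h1.sum_eq, ← h.recurrence _ (by omega)]
  congr 1
  ring

end IsGeneralizedFib

/-- The logarithmic form of `A ^ x - B ^ x = N` when `N` is within `1` of `T`. -/
theorem abs_log_sub_le_of_pow_sub_pow {A B N T : ℝ} {x : ℕ} (hx : 21 ≤ x) (hA : 4 ≤ A)
    (hB : 0 ≤ B) (hBA : 13 * B ≤ 4 * A) (hN : A ^ x - B ^ x = N) (hT : |N - T| ≤ 1) (hT0 : 0 < T) :
    |x * Real.log A - Real.log T| ≤ 2 / 10 ^ 11 := by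
  have hA0 : 0 < A := by linarith
  have hAx : 0 < A ^ x := by positivity
  have h1 : (B / A) ^ x ≤ (4 / 13) ^ 21 := by
    have h2 : B / A ≤ 4 / 13 := by rw [div_le_div_iff₀ hA0 (by norm_num)]; linarith
    exact (pow_le_pow_left₀ (by positivity) h2 x).trans
      (pow_le_pow_of_le_one (by norm_num) (by norm_num) hx)
  have h2 : 1 / A ^ x ≤ (1 / 4) ^ 21 := by
    rw [← one_div_pow]
    exact (pow_le_pow_left₀ (by positivity)
      (one_div_le_one_div_of_le (by norm_num) hA) x).trans
      (pow_le_pow_of_le_one (by norm_num) (by norm_num) hx)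
  have h3 : T / A ^ x - 1 = -(B / A) ^ x - (N - T) / A ^ x := by
    rw [div_pow, ← hN]; field_simp; ring
  have h4 : |T / A ^ x - 1| ≤ (4 / 13) ^ 21 + (1 / 4) ^ 21 := by
    rw [h3]
    refine (abs_sub _ _).trans (add_le_add ?_ ?_)
    · rw [abs_neg, abs_of_nonneg (by positivity)]; exact h1
    · rw [abs_div, abs_of_pos hAx]
      exact (div_le_div_of_nonneg_right hT hAx.le).trans h2
  have h5 := abs_log_le_of_abs_sub_one_le (by norm_num) h4
  rw [Real.log_div hT0.ne' hAx.ne', Real.log_pow, abs_sub_comm] at h5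
  exact h5.trans (by norm_num)

theorem abs_log_sub_log_dominant_le {α c A : ℝ} {m : ℕ} (hα : 9 / 5 ≤ α) (hc : 1 / 2 ≤ c)
    (hm : 72 ≤ m) (h : |A - c * α ^ m| ≤ 1) :
    |2 ^ 96 * (Real.log A - Real.log (c * α ^ m))| ≤ 2 ^ 40 := by
  have h1 : (2 : ℝ) ^ 60 ≤ c * α ^ m := by
    have h2 : (9 / 5 : ℝ) ^ 72 ≤ α ^ m :=
      (pow_le_pow_left₀ (by norm_num) hα 72).trans (pow_le_pow_right₀ (by linarith) hm)
    calc (2 : ℝ) ^ 60 ≤ 1 / 2 * (9 / 5) ^ 72 := by norm_num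
      _ ≤ _ := by gcongr
  set T := c * α ^ m
  have hT : 0 < T := by linarith
  have hA : 0 < A := by linarith [(abs_le.1 h).1]
  have h2 : |A / T - 1| ≤ 1 / 2 ^ 60 := by
    rw [div_sub_one hT.ne', abs_div, abs_of_pos hT]
    exact div_le_div₀ (by norm_num) h (by norm_num) h1
  have h3 := abs_log_le_of_abs_sub_one_le (by norm_num) h2
  rw [Real.log_div hA.ne' hT.ne'] at h3
  rw [abs_mul, abs_of_pos (by norm_num : (0 : ℝ) < 2 ^ 96)]
  exact (mul_le_mul_of_nonneg_left h3 (by norm_num)).trans (by norm_num)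

/-- There are no positive integers `m, n, k, x` with `3 ≤ m ≤ 1457`, `3 ≤ k ≤ 13` and
`21 ≤ x ≤ 850192` satisfying `(F_{m+1}^{(k)})^x − (F_{m-1}^{(k)})^x = F_n^{(k)}`. -/
theorem no_small_solutions_kFib_power_diff
    (k : ℕ) (m n : ℤ) (x : ℕ)
    (hm : 3 ≤ m) (hm' : m ≤ 1457) (hn : 0 < n)
    (hk : 3 ≤ k) (hk' : k ≤ 13)
    (hx : 21 ≤ x) (hx' : x ≤ 850192)
    (F : ℤ → ℤ)
    (hF0 : ∀ i : ℤ, 2 - (k : ℤ) ≤ i → i ≤ 0 → F i = 0)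
    (hF1 : F 1 = 1)
    (hFrec : ∀ i : ℤ, 2 ≤ i → F i = ∑ j ∈ Finset.Icc (1 : ℤ) (k : ℤ), F (i - j)) :
    (F (m + 1)) ^ x - (F (m - 1)) ^ x ≠ F n := by
  intro heq
  have hF : IsGeneralizedFib k F := ⟨hF0, hF1, fun i hi => by
    rw [hFrec _ (by omega), sum_Icc_sub_eq_sum_range]⟩
  obtain ⟨α, hα, hα2, hroot, hla, hlc, ⟨q, hq⟩, htests⟩ := exists_dominant_root hk hk'
  have hden := root_denominator_pos (by linarith) (by omega) hroot
  have hdom := hF.abs_sub_dominant_le_one hk (by linarith) hroot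
  have hc : 1 / 2 ≤ (α - 1) / (α - k * (2 - α)) := by
    have hk3 : (3 : ℝ) ≤ k := by exact_mod_cast hk
    rw [div_le_div_iff₀ (by norm_num) hden]
    nlinarith
  obtain ⟨hA4, hBA⟩ := hF.ratio_le hk hm
  have hB := hF.nonneg (i := m - 1) (by omega)
  obtain ⟨M, rfl⟩ := Int.eq_ofNat_of_zero_le (by omega : 0 ≤ m)
  obtain ⟨v, rfl⟩ : ∃ v : ℕ, n = v + 1 := ⟨(n - 1).toNat, by omega⟩
  have hdm := hdom M
  have hdv := hdom v
  generalize (α - 1) / (α - k * (2 - α)) = c at hlc hc hdm hdv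
  have hα0 : 0 < α := by linarith
  have hc0 : 0 < c := by linarith
  have hlogpow : ∀ j : ℕ, Real.log (c * α ^ j) = Real.log c + j * Real.log α := fun j => by
    rw [Real.log_mul hc0.ne' (by positivity), Real.log_pow]
  have hform := abs_log_sub_le_of_pow_sub_pow (A := F (M + 1)) (B := F (M - 1)) (N := F (v + 1))
    (T := c * α ^ v) hx (by exact_mod_cast hA4) (by exact_mod_cast hB) (by exact_mod_cast hBA)
    (by exact_mod_cast heq) hdv (by positivity)
  rw [hlogpow] at hform
  set la := Real.log α
  set lc := Real.log c
  set lA := Real.log (F (M + 1))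
  -- it remains to approximate the deviation from the leading asymptotics
  suffices h : ∃ R' q : ℤ, |2 ^ 96 * (lA - lc - M * la) - R'| ≤ 2 ^ 40 ∧
      reductionTest (fixedLogRoot k) (fixedLogCoeff k) R' q = true by
    obtain ⟨R', q, hR, hq⟩ := h
    have := lt_abs_of_reductionTest (hla.trans (by norm_num)) (hlc.trans (by norm_num)) hR hq
      (y := x - 1) (by omega) (by omega) (v - x * M)
    have e : ((x - 1 : ℕ) : ℝ) * (lc + (lA - lc - M * la)) + (lA - lc - M * la) -
        ((v - x * M : ℤ) : ℝ) * la = x * lA - (lc + v * la) := by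
      push_cast [Nat.cast_sub (by omega : 1 ≤ x)]
      ring
    rw [e] at this
    linarith
  rcases lt_or_ge M 72 with hM | hM
  · obtain ⟨q, hq⟩ := htests (M - 3) (by omega)
    have hsum := hF.sum_iterate_shiftWindow hk (M - 3 + 2)
    rw [show ((M - 3 + 2 : ℕ) : ℤ) + 2 = M + 1 by omega] at hsum
    rw [show 3 + (M - 3) = M by omega] at hq
    generalize (shiftWindow^[M - 3 + 2] (List.replicate (k - 1) 0 ++ [1])).sum = A at hsum hq
    refine ⟨_, q, ?_, hq⟩
    have hAlt : A < 2 ^ 128 := by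
      have h1 := hF.le_two_pow hk M
      rw [← hsum] at h1
      have h2 : A ≤ 2 ^ M := by exact_mod_cast h1
      exact h2.trans_lt (Nat.pow_lt_pow_right (by norm_num) (by omega))
    have hlA := abs_fixedLog_sub_le (N := A) (by omega) hAlt
    have hAr : ((A : ℕ) : ℝ) = F (M + 1) := by rw [← hsum]; norm_cast
    rw [hAr] at hlA
    have hMr : (M : ℝ) ≤ 72 := by exact_mod_cast hM.le
    have hM0 : (0 : ℝ) ≤ M := by positivity
    have h3 : |(M : ℝ) * (2 ^ 96 * la - fixedLogRoot k)| ≤ 72 * 2 ^ 17 := by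
      rw [abs_mul, abs_of_nonneg hM0]; gcongr
    push_cast
    rw [abs_le] at *
    constructor <;> linarith
  · refine ⟨0, q, ?_, hq⟩
    have h1 := abs_log_sub_log_dominant_le hα hc hM hdm
    rw [hlogpow] at h1
    rw [Int.cast_zero, sub_zero, sub_sub]
    exact h1
end

section
/- Let k ≥ 2 be an integer, let α be the unique real root in (1,2) of Ψ_k(x) = x^k − x^{k−1} − ⋯ − x − 1, and set g := (α − 1)/(2 + (k + 1)(α − 2)). Then for every integer n ≥ 1, |F_n^{(k)} − g·α^{n−1}| < 1/2. -/
/-- Shifting a weighted geometric window of a sequence by one step. -/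
lemma inv_mul_sum_geom_shift (b : ℝ) (e : ℕ → ℝ) (m k : ℕ) :
    b * ∑ i ∈ Finset.range k, b ^ (i + 1) * e (m + 1 + i) =
      ∑ i ∈ Finset.range k, b ^ (i + 1) * e (m + i) - b * e m + b ^ (k + 1) * e (m + k) := by
  induction k with
  | zero => simp
  | succ k ih =>
    rw [Finset.sum_range_succ, mul_add, ih, Finset.sum_range_succ,
      show m + 1 + k = m + (k + 1) by omega]
    ring

/-- A `k`-step Fibonacci sequence satisfies a three-term recurrence. -/
lemma kStep_sum_succ (k : ℕ) (e : ℕ → ℝ)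
    (hrec : ∀ m, e (m + k) = ∑ i ∈ Finset.range k, e (m + i)) (m : ℕ) :
    e (m + 1 + k) = 2 * e (m + k) - e m := by
  have h1 := Finset.sum_range_succ (fun i => e (m + i)) k
  have h2 := Finset.sum_range_succ' (fun i => e (m + i)) k
  have h3 : ∑ i ∈ Finset.range k, e (m + (i + 1)) = e (m + 1 + k) := by
    rw [hrec (m + 1)]
    exact Finset.sum_congr rfl fun i _ => by congr 1; omega
  simp only [add_zero] at h1 h2
  linarith [hrec m]

/-- If the component along the dominant root vanishes, a `k`-step Fibonacci sequence is
determined by averaging with weights `α⁻¹, …, α⁻ᵏ`. -/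
lemma kStep_eq_weighted_sum (k : ℕ) (α : ℝ) (hα : α ≠ 0) (hpow : α⁻¹ ^ k = 2 - α) (e : ℕ → ℝ)
    (hrec : ∀ m, e (m + k) = ∑ i ∈ Finset.range k, e (m + i))
    (h0 : e k = ∑ i ∈ Finset.range k, α⁻¹ ^ (i + 1) * e i) (m : ℕ) :
    e (m + k) = ∑ i ∈ Finset.range k, α⁻¹ ^ (i + 1) * e (m + i) := by
  induction m with
  | zero => simpa using h0
  | succ m ih =>
    have h1 := inv_mul_sum_geom_shift α⁻¹ e m k
    rw [← ih, pow_succ, hpow] at h1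
    rw [kStep_sum_succ k e hrec m]
    apply mul_left_cancel₀ (inv_ne_zero hα)
    rw [h1]
    field_simp
    ring

/-- A sequence whose terms are averages of the `k` preceding ones inherits a strict bound on its
first `k` terms. -/
lemma abs_lt_of_weighted_sum (k : ℕ) (hk : 0 < k) (w : ℕ → ℝ) (hw : ∀ i, 0 < w i)
    (hsum : ∑ i ∈ Finset.range k, w i = 1) (e : ℕ → ℝ) (c : ℝ)
    (hrec : ∀ m, e (m + k) = ∑ i ∈ Finset.range k, w i * e (m + i))
    (hinit : ∀ i < k, |e i| < c) (m : ℕ) : |e m| < c := by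
  induction m using Nat.strong_induction_on with
  | _ m ih =>
    by_cases hm : m < k
    · exact hinit m hm
    obtain ⟨j, rfl⟩ := Nat.exists_eq_add_of_le' (not_lt.mp hm)
    rw [hrec]
    calc |∑ i ∈ Finset.range k, w i * e (j + i)|
        ≤ ∑ i ∈ Finset.range k, |w i * e (j + i)| := Finset.abs_sum_le_sum_abs _ _
      _ < ∑ i ∈ Finset.range k, w i * c := by
          refine Finset.sum_lt_sum_of_nonempty ⟨0, Finset.mem_range.mpr hk⟩ fun i hi => ?_
          rw [abs_mul, abs_of_pos (hw i)]
          have := Finset.mem_range.mp hi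
          exact mul_lt_mul_of_pos_left (ih _ (by omega)) (hw i)
      _ = c := by rw [← Finset.sum_mul, hsum, one_mul]

lemma kStep_root_pow (k : ℕ) (α : ℝ) (hroot : α ^ k = ∑ i ∈ Finset.range k, α ^ i) :
    α ^ k * (2 - α) = 1 := by
  have := geom_sum_mul α k
  rw [← hroot] at this
  linarith

lemma add_one_lt_two_mul_root_pow (k : ℕ) (α : ℝ) (hα : 1 < α)
    (hroot : α ^ (k + 2) = ∑ i ∈ Finset.range (k + 2), α ^ i) :
    (k : ℝ) + 3 < 2 * α ^ (k + 1) := by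
  have hsq : α + 1 ≤ α ^ 2 := by
    have hpos : 0 < α ^ k := by positivity
    have hnn : 0 ≤ ∑ i ∈ Finset.range k, α ^ i := by positivity
    rw [Finset.sum_range_succ, Finset.sum_range_succ] at hroot
    have : α ^ k * (α + 1) ≤ α ^ k * α ^ 2 := by
      rw [← pow_add, hroot, pow_succ]; linarith
    exact le_of_mul_le_mul_left this hpos
  have h16 : (8 / 5 : ℝ) < α := by nlinarith
  have hbern : ∀ j : ℕ, (j : ℝ) + 3 < 2 * (8 / 5 : ℝ) ^ (j + 1) := by
    intro j
    induction j with
    | zero => norm_num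
    | succ j ih =>
      have : (0 : ℝ) ≤ j := j.cast_nonneg
      rw [pow_succ]; push_cast; linarith
  have := pow_le_pow_left₀ (by norm_num) h16.le (k + 1)
  linarith [hbern k]

/-- Dresden: with `α` the dominant root and `g = (α−1)/(2+(k+1)(α−2))`, for every
integer `n ≥ 1` one has `|F_n^{(k)} − g·α^{n−1}| < 1/2`. -/
theorem kFib_dresden_error_bound
    (k : ℕ) (hk : 2 ≤ k)
    (F : ℤ → ℤ)
    (hF0 : ∀ i : ℤ, 2 - (k : ℤ) ≤ i → i ≤ 0 → F i = 0)
    (hF1 : F 1 = 1)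
    (hFrec : ∀ i : ℤ, 2 ≤ i → F i = ∑ j ∈ Finset.Icc (1 : ℤ) (k : ℤ), F (i - j))
    (α : ℝ) (hα1 : 1 < α) (hα2 : α < 2)
    (hroot : α ^ k = ∑ i ∈ Finset.range k, α ^ i)
    (g : ℝ) (hg : g = (α - 1) / (2 + ((k : ℝ) + 1) * (α - 2)))
    (n : ℤ) (hn : 1 ≤ n) :
    |(F n : ℝ) - g * α ^ (n - 1)| < 1 / 2 := by
  obtain ⟨l, rfl⟩ := Nat.exists_eq_add_of_le' hk
  have hα0 : 0 < α := by linarith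
  have hpow := kStep_root_pow _ _ hroot
  have hinv : α⁻¹ ^ (l + 2) = 2 - α := by
    rw [inv_pow]; exact inv_eq_of_mul_eq_one_right hpow
  have hgrow := add_one_lt_two_mul_root_pow l α hα1 hroot
  have hl : (0 : ℝ) ≤ l := l.cast_nonneg
  push_cast at hg
  -- the bound `(k + 1) (2 - α) α < 2`
  have hkey : ((l : ℝ) + 3) * (2 - α) * α < 2 := by
    have h := mul_lt_mul_of_pos_right hgrow (show 0 < (2 - α) * α by nlinarith)
    have : 2 * α ^ (l + 1) * ((2 - α) * α) = 2 := by
      rw [pow_succ] at hpow; linear_combination 2 * hpow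
    linarith
  have hden : 0 < 2 + ((l : ℝ) + 2 + 1) * (α - 2) := by
    nlinarith [mul_nonneg (by linarith : (0 : ℝ) ≤ l + 3) (by linarith : 0 ≤ 2 - α)]
  have hgeq : g * (2 + ((l : ℝ) + 2 + 1) * (α - 2)) = α - 1 := by
    rw [hg]; field_simp
  have hg_lower : 1 / 2 < g := by
    rw [hg, lt_div_iff₀ hden]; nlinarith
  have hg_upper : g < α / 2 := by
    rw [hg, div_lt_iff₀ hden]; nlinarith
  let e : ℕ → ℝ := fun m => (F ((m : ℤ) - l) : ℝ) - g * (α ^ m / α ^ (l + 1))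
  have he_init : ∀ i < l + 1, e i = -(g * (α ^ i / α ^ (l + 1))) := by
    intro i hi
    simp only [e]
    rw [hF0 _ (by push_cast; omega) (by omega)]; simp
  have he_one : e (l + 1) = 1 - g := by
    have : ((l + 1 : ℕ) : ℤ) - l = 1 := by push_cast; ring
    simp only [e]
    rw [this, hF1, div_self (by positivity)]; simp
  have hrec : ∀ m, e (m + (l + 2)) = ∑ i ∈ Finset.range (l + 2), e (m + i) := by
    intro m
    have hF : F (((m + (l + 2) : ℕ) : ℤ) - l) =
        ∑ i ∈ Finset.range (l + 2), F (((m + i : ℕ) : ℤ) - l) := by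
      rw [hFrec _ (by push_cast; omega)]
      symm
      refine Finset.sum_bij (fun i _ => ((l : ℤ) + 2 - i)) ?_ ?_ ?_ ?_
      · intro i hi
        simp only [Finset.mem_range] at hi
        simp only [Finset.mem_Icc]; push_cast; omega
      · intro a _ b _ h; omega
      · intro b hb
        simp only [Finset.mem_Icc] at hb
        push_cast at hb
        exact ⟨((l : ℤ) + 2 - b).toNat, by simp only [Finset.mem_range]; omega, by omega⟩
      · intro i _
        congr 1; push_cast; ring
    simp only [e]
    rw [hF, Finset.sum_sub_distrib, ← Finset.mul_sum, ← Finset.sum_div]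
    simp only [pow_add α m]
    rw [← Finset.mul_sum, ← hroot]
    push_cast; ring
  have hweights : ∑ i ∈ Finset.range (l + 2), α⁻¹ ^ (i + 1) = 1 := by
    have h := geom_sum_mul α⁻¹ (l + 2)
    rw [hinv] at h
    simp only [pow_succ]
    rw [← Finset.sum_mul]
    have h1 : α⁻¹ - 1 ≠ 0 := by
      have := inv_lt_one_of_one_lt₀ hα1
      linarith
    apply mul_right_cancel₀ h1
    rw [mul_right_comm, h]
    field_simp
    ring
  have h0 : e (l + 2) = ∑ i ∈ Finset.range (l + 2), α⁻¹ ^ (i + 1) * e i := by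
    have hconst : ∀ i ∈ Finset.range (l + 1), α⁻¹ ^ (i + 1) * e i = -(g * (2 - α)) := by
      intro i hi
      rw [he_init i (Finset.mem_range.mp hi), ← hinv, inv_pow, inv_pow]
      field_simp
      ring
    have hsum : e (l + 2) = 1 - g * α := by
      have := hrec 0
      simp only [zero_add] at this
      have h2 : ((l + 2 : ℕ) : ℤ) - l = 2 := by push_cast; ring
      have hF2 : F 2 = 1 := by
        rw [hFrec 2 le_rfl, Finset.sum_eq_single 1]
        · simpa using hF1
        · intro b hb hb1
          simp only [Finset.mem_Icc] at hb
          exact hF0 _ (by push_cast at hb ⊢; omega) (by omega)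
        · intro h
          exact absurd (Finset.mem_Icc.mpr ⟨le_rfl, by push_cast; omega⟩) h
      simp only [e]
      rw [h2, hF2, pow_succ α (l + 1)]
      field_simp
      simp
    rw [Finset.sum_range_succ, Finset.sum_congr rfl hconst, Finset.sum_const, Finset.card_range,
      nsmul_eq_mul, he_one, hsum, hinv]
    push_cast
    linear_combination -hgeq
  have hbound := abs_lt_of_weighted_sum (l + 2) (by omega) (fun i => α⁻¹ ^ (i + 1))
    (fun i => by positivity) hweights e (1 / 2)
    (kStep_eq_weighted_sum (l + 2) α hα0.ne' hinv e hrec h0) (by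
      intro i hi
      rcases Nat.lt_succ_iff_lt_or_eq.mp hi with hi | rfl
      · rw [he_init i hi, abs_neg, abs_of_pos (by positivity)]
        have hle : α ^ i / α ^ (l + 1) ≤ 1 / α := by
          rw [div_le_div_iff₀ (by positivity) hα0, one_mul, ← pow_succ]
          exact pow_le_pow_right₀ hα1.le (by omega)
        calc g * (α ^ i / α ^ (l + 1)) ≤ g * (1 / α) :=
              mul_le_mul_of_nonneg_left hle (by linarith)
          _ < 1 / 2 := by rw [mul_one_div, div_lt_iff₀ hα0]; linarith
      · rw [he_one, abs_lt]
        constructor <;> linarith)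
  obtain ⟨p, rfl⟩ : ∃ p : ℕ, n = p + 1 := ⟨(n - 1).toNat, by omega⟩
  have := hbound (p + (l + 1))
  have hidx : ((p + (l + 1) : ℕ) : ℤ) - l = p + 1 := by push_cast; ring
  simp only [e] at this
  rw [hidx, pow_add, mul_div_cancel_right₀ _ (by positivity)] at this
  simpa using this
end

section
/- Let k ≥ 2 be an integer, α the unique real root in (1,2) of Ψ_k(x) = x^k − x^{k−1} − ⋯ − x − 1, and g := (α − 1)/(2 + (k + 1)(α − 2)). Then α and g are multiplicatively independent: if a, b are integers with g^a · α^b = 1, then a = 0 and b = 0. -/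
open Polynomial in
/-- In a number field other than `ℚ`, generated by an algebraic integer `x`, the derivative of an
integer polynomial vanishing at `x` does not take a unit value at `x`. -/
theorem not_isUnit_aeval_derivative {K : Type*} [Field K] [NumberField K]
    (hK : 1 < Module.finrank ℚ K) (x : NumberField.RingOfIntegers K)
    (hx : Algebra.adjoin ℚ {algebraMap (NumberField.RingOfIntegers K) K x} = ⊤)
    {P : ℤ[X]} (hP : aeval x P = 0) : ¬ IsUnit (aeval x (derivative P)) := by
  intro hu
  have h_int : IsIntegral ℤ x := Algebra.IsIntegral.isIntegral x
  obtain ⟨q, rfl⟩ := minpoly.isIntegrallyClosed_dvd h_int hP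
  have hmem := aeval_derivative_mem_differentIdeal ℤ ℚ K x hx
  have htop : differentIdeal ℤ (NumberField.RingOfIntegers K) = ⊤ := by
    refine Ideal.eq_top_of_isUnit_mem _ ?_ hu
    simpa [derivative_mul] using Ideal.mul_mem_right (aeval x q) _ hmem
  have hnorm := NumberField.absNorm_differentIdeal K (NumberField.RingOfIntegers K)
  rw [htop, Ideal.absNorm_top] at hnorm
  have := NumberField.abs_discr_gt_two hK
  rw [Int.abs_eq_natAbs, ← hnorm] at this
  norm_num at this

open Polynomial IntermediateField in
/-- If a real algebraic integer `α` is not an integer, then the inverse of a nonzero value at `α`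
of the derivative of an integer polynomial vanishing at `α` is not an algebraic integer. -/
theorem not_isIntegral_inv_aeval_derivative {α : ℝ} (hα : IsIntegral ℤ α)
    (hne : ∀ n : ℤ, (n : ℝ) ≠ α) {P : ℤ[X]} (hP : aeval α P = 0)
    (h0 : aeval α (derivative P) ≠ 0) : ¬ IsIntegral ℤ (aeval α (derivative P))⁻¹ := by
  intro hinv
  have hαQ : IsIntegral ℚ α := hα.tower_top
  have : FiniteDimensional ℚ ℚ⟮α⟯ := adjoin.finiteDimensional hαQ
  have : NumberField ℚ⟮α⟯ := ⟨⟩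
  have hinj : Function.Injective (algebraMap ℚ⟮α⟯ ℝ) := (algebraMap ℚ⟮α⟯ ℝ).injective
  have hgen : IsIntegral ℤ (AdjoinSimple.gen ℚ α) := by
    rw [← isIntegral_algebraMap_iff hinj]
    simpa using hα
  let x : NumberField.RingOfIntegers ℚ⟮α⟯ := ⟨AdjoinSimple.gen ℚ α, hgen⟩
  have hcoe (Q : ℤ[X]) : algebraMap ℚ⟮α⟯ ℝ
      (algebraMap (NumberField.RingOfIntegers ℚ⟮α⟯) ℚ⟮α⟯ (aeval x Q)) = aeval α Q := by
    rw [← aeval_algebraMap_apply, ← aeval_algebraMap_apply]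
    rfl
  have hfin : 1 < Module.finrank ℚ ℚ⟮α⟯ := by
    have hpos : 0 < Module.finrank ℚ ℚ⟮α⟯ := Module.finrank_pos
    have hne1 : Module.finrank ℚ ℚ⟮α⟯ ≠ 1 := by
      rw [Ne, finrank_adjoin_simple_eq_one_iff]
      intro hbot
      obtain ⟨r, hr⟩ := mem_bot.mp hbot
      have hrint : IsIntegral ℤ r := by
        rw [← isIntegral_algebraMap_iff (algebraMap ℚ ℝ).injective, hr]
        exact hα
      obtain ⟨n, hn⟩ := IsIntegrallyClosed.isIntegral_iff.mp hrint
      apply hne n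
      rw [← hr, ← hn]
      simp
    omega
  have hadj : Algebra.adjoin ℚ
      {algebraMap (NumberField.RingOfIntegers ℚ⟮α⟯) ℚ⟮α⟯ x} = ⊤ := by
    have h := (adjoin.powerBasis hαQ).adjoin_gen_eq_top
    rwa [adjoin.powerBasis_gen] at h
  refine not_isUnit_aeval_derivative hfin x hadj (P := P) ?_ ?_
  · apply NumberField.RingOfIntegers.coe_injective
    apply hinj
    rw [hcoe, hP]
    simp
  · have hyint : IsIntegral ℤ
        (algebraMap (NumberField.RingOfIntegers ℚ⟮α⟯) ℚ⟮α⟯ (aeval x (derivative P)))⁻¹ := by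
      rw [← isIntegral_algebraMap_iff hinj, map_inv₀, hcoe]
      exact hinv
    obtain ⟨y, hy⟩ : ∃ y : NumberField.RingOfIntegers ℚ⟮α⟯,
        algebraMap (NumberField.RingOfIntegers ℚ⟮α⟯) ℚ⟮α⟯ y =
          (algebraMap (NumberField.RingOfIntegers ℚ⟮α⟯) ℚ⟮α⟯ (aeval x (derivative P)))⁻¹ :=
      ⟨⟨_, hyint⟩, rfl⟩
    refine IsUnit.of_mul_eq_one y ?_
    apply NumberField.RingOfIntegers.coe_injective
    apply hinj
    rw [map_mul, map_mul, hcoe, map_one, map_one, hy, map_inv₀, hcoe, mul_inv_cancel₀ h0]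

/-- Integer powers of an integral element with integral inverse are integral. -/
theorem isIntegral_zpow {R K : Type*} [CommRing R] [Field K] [Algebra R K] {x : K}
    (hx : IsIntegral R x) (hx' : IsIntegral R x⁻¹) (m : ℤ) : IsIntegral R (x ^ m) := by
  obtain ⟨n, rfl | rfl⟩ := m.eq_nat_or_neg
  · simpa using hx.pow n
  · simpa using hx'.pow n

open Polynomial in
/-- The `k`-bonacci polynomial `X ^ k - X ^ (k - 1) - ⋯ - X - 1`. -/
noncomputable def bonacciPoly (k : ℕ) : ℤ[X] := X ^ k - ∑ i ∈ Finset.range k, X ^ i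

open Polynomial in
theorem bonacciPoly_mul (k : ℕ) :
    (X - 1) * bonacciPoly k = X ^ (k + 1) - 2 * X ^ k + 1 := by
  have h := mul_geom_sum (X : ℤ[X]) k
  rw [bonacciPoly, mul_sub, h]
  ring

open Polynomial in
theorem aeval_derivative_bonacciPoly (k : ℕ) {α : ℝ} (hα : aeval α (bonacciPoly (k + 1)) = 0) :
    (α - 1) * aeval α (derivative (bonacciPoly (k + 1))) =
      α ^ k * (2 + (((k + 1 : ℕ) : ℝ) + 1) * (α - 2)) := by
  have h := congrArg (fun Q => aeval α (derivative Q)) (bonacciPoly_mul (k + 1))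
  simp [derivative_mul, hα, map_ofNat (aeval α) 2] at h
  rw [h]
  push_cast
  ring

open Polynomial in
theorem isIntegral_of_aeval_bonacciPoly (k : ℕ) {α : ℝ} (hα : aeval α (bonacciPoly (k + 1)) = 0) :
    IsIntegral ℤ α ∧ IsIntegral ℤ α⁻¹ := by
  have h_int : IsIntegral ℤ α := by
    refine ⟨bonacciPoly (k + 1), ?_, by simpa [aeval_def] using hα⟩
    refine monic_X_pow_sub ((degree_sum_le _ _).trans_lt ?_)
    rw [Finset.sup_lt_iff (WithBot.bot_lt_coe _)]
    intro i hi
    rw [degree_X_pow]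
    exact_mod_cast Finset.mem_range.mp hi
  refine ⟨h_int, ?_⟩
  have hinv : α⁻¹ = α ^ k - ∑ i ∈ Finset.range k, α ^ i := by
    apply inv_eq_of_mul_eq_one_left
    simp only [bonacciPoly, map_sub, map_sum, map_pow, aeval_X] at hα
    simp only [Finset.sum_range_succ', pow_succ, ← Finset.sum_mul, pow_zero] at hα
    linarith
  rw [hinv]
  exact (h_int.pow k).sub (IsIntegral.sum _ fun i _ => h_int.pow i)

/-- `α` and `g` are multiplicatively independent: if `g^a · α^b = 1` for integers `a, b`,
then `a = 0` and `b = 0`. -/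
theorem alpha_g_multiplicatively_independent
    (k : ℕ) (hk : 2 ≤ k)
    (α : ℝ) (hα1 : 1 < α) (hα2 : α < 2)
    (hroot : α ^ k = ∑ i ∈ Finset.range k, α ^ i)
    (g : ℝ) (hg : g = (α - 1) / (2 + ((k : ℝ) + 1) * (α - 2)))
    (a b : ℤ) (hab : g ^ a * α ^ b = 1) :
    a = 0 ∧ b = 0 := by
  have hα0 : α ≠ 0 := by positivity
  by_cases ha : a = 0
  · subst ha
    refine ⟨rfl, ?_⟩
    rw [zpow_zero, one_mul] at hab
    exact (zpow_eq_one_iff_right₀ (by positivity) hα1.ne').mp hab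
  exfalso
  have hg0 : g ≠ 0 := by
    rintro rfl
    simp [zero_zpow a ha] at hab
  obtain ⟨j, rfl⟩ : ∃ j, k = j + 1 := ⟨k - 1, by omega⟩
  have hP : Polynomial.aeval α (bonacciPoly (j + 1)) = 0 := by
    simp [bonacciPoly, hroot]
  obtain ⟨h_int, h_int'⟩ := isIntegral_of_aeval_bonacciPoly j hP
  have hden : 2 + (((j + 1 : ℕ) : ℝ) + 1) * (α - 2) ≠ 0 := by
    intro h
    rw [h, div_zero] at hg
    exact hg0 hg
  have hα1' : α - 1 ≠ 0 := sub_ne_zero.mpr hα1.ne'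
  set D := Polynomial.aeval α (Polynomial.derivative (bonacciPoly (j + 1))) with hD
  have hderiv : D = α ^ j * g⁻¹ := by
    have h := aeval_derivative_bonacciPoly j hP
    rw [hg, inv_div, ← mul_div_assoc, ← h, mul_div_cancel_left₀ _ hα1']
  have hD0 : D ≠ 0 := by
    rw [hderiv]
    positivity
  have hpow : D ^ a = α ^ ((j : ℤ) * a + b) := by
    rw [hderiv, mul_zpow, inv_zpow, ← eq_inv_of_mul_eq_one_right hab, zpow_add₀ hα0, zpow_mul,
      zpow_natCast]
  refine not_isIntegral_inv_aeval_derivative h_int ?_ hP hD0 ?_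
  · rintro n rfl
    have h1 : 1 < n := by exact_mod_cast hα1
    have h2 : n < 2 := by exact_mod_cast hα2
    omega
  · refine IsIntegral.of_pow (Int.natAbs_pos.mpr ha) ?_
    rw [← hD]
    rcases Int.natAbs_eq a with h | h
    · have : D⁻¹ ^ a.natAbs = α ^ (-((j : ℤ) * a + b)) := by
        rw [zpow_neg, ← hpow, inv_pow, ← zpow_natCast, ← h]
      rw [this]
      exact isIntegral_zpow h_int h_int' _
    · have : D⁻¹ ^ a.natAbs = α ^ ((j : ℤ) * a + b) := by
        rw [← hpow, inv_pow, ← zpow_natCast, ← zpow_neg, ← h]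
      rw [this]
      exact isIntegral_zpow h_int h_int' _
end
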